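/- arXiv:2208.08160 — 6 statements merged into one kernel-verified Lean document; each statement's English description precedes it below -/
import Mathlib

section
/- Let k ≥ 2 and let d be a positive integer with d ≤ k − 2. If a profile Π of I preferences over A alternatives contains a circulant pathology of size k as a sub-profile, then Π is not d-Euclidean; that is, there do not exist points x^1,…,x^A ∈ ℝ^d and w^1,…,w^I ∈ ℝ^d such that for all alternatives a, b and every individual i, a >_i b ↔ ‖x^a − w^i‖ < ‖x^b − w^i‖. -/
/-- Maximum principle: if every row of `D` sums to zero and each row `r i` is positive away from
the entry `i`, then a nonconstant `c` cannot be mapped by `D` to a nonnegative constant. -/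
theorem neg_of_forall_sum_mul_eq {ι κ : Type*} [Fintype ι] [Nonempty ι]
    (D : κ → ι → ℝ) (r : ι → κ) (hsum : ∀ j, ∑ i, D j i = 0)
    (hpos : ∀ i b, b ≠ i → 0 < D (r i) b) (c : ι → ℝ) (hc : ∃ a b, c a ≠ c b)
    (s : ℝ) (hs : ∀ j, ∑ i, D j i * c i = s) : s < 0 := by
  obtain ⟨m, hm⟩ := Finite.exists_max c
  have h1 : ∑ i, D (r m) i * (c i - c m) = s := by
    simp only [mul_sub, Finset.sum_sub_distrib, ← Finset.sum_mul, hsum, hs]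
    ring
  have hterm : ∀ i, D (r m) i * (c i - c m) ≤ 0 := by
    intro i
    by_cases h : i = m
    · simp [h]
    · exact mul_nonpos_of_nonneg_of_nonpos (hpos m i h).le (sub_nonpos.2 (hm i))
  obtain ⟨b, hb⟩ : ∃ b, c b ≠ c m := by
    by_contra! h
    obtain ⟨a, b, hab⟩ := hc
    exact hab ((h a).trans (h b).symm)
  have hbm : b ≠ m := fun h => hb (h ▸ rfl)
  rw [← h1, ← Finset.sum_const_zero (s := (Finset.univ : Finset ι))]
  exact Finset.sum_lt_sum (fun i _ => hterm i) ⟨b, Finset.mem_univ b,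
    mul_neg_of_pos_of_neg (hpos m b hbm) (sub_neg.2 (lt_of_le_of_ne (hm b) hb))⟩

/-- More than `finrank + 1` vectors admit a nonconstant linear relation. -/
theorem exists_nonconstant_relation {ι E : Type*} [Fintype ι] [AddCommGroup E] [Module ℝ E]
    [FiniteDimensional ℝ E] (y : ι → E) (h : Module.finrank ℝ E + 1 < Fintype.card ι) :
    ∃ c : ι → ℝ, ∑ i, c i • y i = 0 ∧ ∃ a b, c a ≠ c b := by
  have hdep : ¬ LinearIndependent ℝ (fun i => (y i, (1 : ℝ))) := by
    intro hli
    have := hli.fintype_card_le_finrank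
    rw [Module.finrank_prod, Module.finrank_self] at this
    omega
  obtain ⟨c, hc, i, hi⟩ := Fintype.not_linearIndependent_iff.1 hdep
  have hy : ∑ i, c i • y i = 0 := by simpa [Prod.fst_sum] using congrArg Prod.fst hc
  have hone : ∑ i, c i = 0 := by simpa [Prod.snd_sum] using congrArg Prod.snd hc
  refine ⟨c, hy, ?_⟩
  by_contra! hconst
  rw [Finset.sum_congr rfl fun j _ => hconst j i, Finset.sum_const, Finset.card_univ,
    nsmul_eq_mul, mul_eq_zero, Nat.cast_eq_zero] at hone
  rcases hone with h0 | h0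
  · omega
  · exact hi h0


/-- A profile `P` of `I` preferences over `A` alternatives (each preference a
ranking, i.e. a permutation of `Fin A`, where alternative `a` is preferred to `b`
by individual `i` iff `P i a < P i b`) that contains a circulant pathology of
size `k ≥ 2` is not `d`-Euclidean for any positive `d ≤ k - 2`. -/
theorem not_euclidean_of_circulant_pathology
    (A I d k : ℕ) (hd : 1 ≤ d) (hk : 2 ≤ k) (hdk : d ≤ k - 2)
    (P : Fin I → Equiv.Perm (Fin A))
    (hpath : ∃ (a : Fin k → Fin A) (ind : Fin k → Fin I),
      Function.Injective a ∧ Function.Injective ind ∧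
      ∀ (j p q : Fin k), p < q →
        (P (ind j)) (a (j + p)) < (P (ind j)) (a (j + q))) :
    ¬ ∃ (x : Fin A → EuclideanSpace ℝ (Fin d)) (w : Fin I → EuclideanSpace ℝ (Fin d)),
      ∀ (i : Fin I) (a b : Fin A),
        (P i) a < (P i) b ↔ ‖x a - w i‖ < ‖x b - w i‖ := by
  rintro ⟨x, w, hxw⟩
  obtain ⟨a, ind, -, -, hcirc⟩ := hpath
  obtain ⟨n, rfl⟩ := Nat.exists_eq_add_of_le' hk
  let D : Fin (n + 2) → Fin (n + 2) → ℝ := fun j i =>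
    ‖x (a (i + 1)) - w (ind j)‖ ^ 2 - ‖x (a i) - w (ind j)‖ ^ 2
  have hsum : ∀ j, ∑ i, D j i = 0 := by
    intro j
    simp only [D, Finset.sum_sub_distrib, sub_eq_zero]
    exact Equiv.sum_comp (Equiv.addRight (1 : Fin (n + 2)))
      fun i => ‖x (a i) - w (ind j)‖ ^ 2
  have hpos : ∀ i b, b ≠ i → 0 < D (i + 1) b := by
    intro i b hb
    have hp : b - (i + 1) < b - (i + 1) + 1 := by
      rw [Fin.lt_add_one_iff, Fin.lt_last_iff_ne_last]
      intro h
      apply hb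
      have h' : b - (i + 1) + 1 = 0 := by rw [h, Fin.last_add_one]
      rwa [← sub_sub, sub_add_cancel, sub_eq_zero] at h'
    have hlt := hcirc (i + 1) _ _ hp
    rw [← add_assoc, add_sub_cancel, hxw] at hlt
    exact sub_pos.2 (pow_lt_pow_left₀ hlt (norm_nonneg _) two_ne_zero)
  obtain ⟨c, hc, p, q, hpq⟩ := exists_nonconstant_relation
    (fun i => x (a (i + 1)) - x (a i)) (by simp; omega)
  have hconst : ∀ j, ∑ i, D j i * c i =
      ∑ i, (‖x (a (i + 1))‖ ^ 2 - ‖x (a i)‖ ^ 2) * c i := by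
    intro j
    have hinner := congrArg (fun v => inner ℝ v (w (ind j))) hc
    simp only [sum_inner, inner_smul_left, inner_zero_left, conj_trivial] at hinner
    rw [← sub_eq_zero, ← Finset.sum_sub_distrib, ← mul_zero (-2 : ℝ), ← hinner, Finset.mul_sum]
    refine Finset.sum_congr rfl fun i _ => ?_
    simp only [D, norm_sub_sq_real, inner_sub_left]
    ring
  have hneg := neg_of_forall_sum_mul_eq D (· + 1) hsum hpos c ⟨p, q, hpq⟩ _ hconst
  have hneg' := neg_of_forall_sum_mul_eq D (· + 1) hsum hpos (-c)
    ⟨p, q, by simpa using hpq⟩ _ (fun j => by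
      simp only [Pi.neg_apply, mul_neg, Finset.sum_neg_distrib, hconst j]; rfl)
  linarith
end

section
/- For all positive integers I, A, d with d < min{I − 1, A − 1}, there exists a profile of I preferences over A alternatives that is not d-Euclidean. -/
/-- Abel summation: pairing a strictly increasing sequence with weights of total zero and
nonnegative partial sums gives a negative number unless all weights vanish. -/
lemma eq_zero_of_sum_mul_nonneg_of_partial_sums_nonneg (n : ℕ) (ν g : ℕ → ℝ)
    (hg : ∀ k, k + 1 < n → g k < g (k + 1))
    (hpos : ∀ k, 0 ≤ ∑ j ∈ Finset.range k, ν j)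
    (htot : ∑ j ∈ Finset.range n, ν j = 0)
    (hsum : 0 ≤ ∑ j ∈ Finset.range n, g j * ν j) :
    ∀ k < n, ν k = 0 := by
  have key := Finset.sum_range_by_parts g ν n
  simp only [smul_eq_mul, htot, mul_zero, zero_sub] at key
  have hterm : ∀ j ∈ Finset.range (n - 1),
      0 ≤ (g (j + 1) - g j) * ∑ i ∈ Finset.range (j + 1), ν i := fun j hj =>
    mul_nonneg (sub_nonneg.2 (hg j (by grind)).le) (hpos _)
  have hzero := (Finset.sum_eq_zero_iff_of_nonneg hterm).1
    (le_antisymm (by linarith) (Finset.sum_nonneg hterm))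
  have hpartial : ∀ k ≤ n, ∑ j ∈ Finset.range k, ν j = 0 := by
    intro k hk
    rcases k with _ | k
    · simp
    rcases hk.eq_or_lt with rfl | hk
    · exact htot
    · exact (mul_eq_zero.1 (hzero k (by grind))).resolve_left (sub_pos.2 (hg k hk)).ne'
  intro k hk
  have h := Finset.sum_range_succ ν k
  rw [hpartial k hk.le, hpartial (k + 1) hk] at h
  linarith

/-- A periodic sequence whose sum over a period vanishes has a starting point from which all
partial sums are nonnegative. -/
lemma exists_partial_sums_nonneg_of_periodic {n : ℕ} (hn : 0 < n) (ν : ℕ → ℝ)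
    (hper : Function.Periodic ν n) (htot : ∑ j ∈ Finset.range n, ν j = 0) :
    ∃ i < n, ∀ k, 0 ≤ ∑ j ∈ Finset.range k, ν (i + j) := by
  have hT : Function.Periodic (fun m => ∑ j ∈ Finset.range m, ν j) n := fun m => by
    simp only [add_comm m n, Finset.sum_range_add, htot, zero_add]
    exact Finset.sum_congr rfl fun j _ => by rw [add_comm, hper]
  obtain ⟨i, hi, hmin⟩ := Finset.exists_min_image (Finset.range n)
    (fun m => ∑ j ∈ Finset.range m, ν j) ⟨0, by simpa using hn⟩
  refine ⟨i, by simpa using hi, fun k => ?_⟩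
  have h := hmin ((i + k) % n) (by simpa using Nat.mod_lt _ hn)
  rw [hT.map_mod_nat (i + k)] at h
  rw [Finset.sum_range_add] at h
  linarith

/-- For weights `μ` summing to zero with `∑ μ a • x a = 0`, the `μ`-weighted sum of the squared
distances to a point does not depend on the point. -/
lemma sum_mul_norm_sub_sq_of_sum_smul_eq_zero {ι E : Type*} [Fintype ι] [NormedAddCommGroup E]
    [InnerProductSpace ℝ E] (μ : ι → ℝ) (x : ι → E) (hμ : ∑ a, μ a = 0)
    (hx : ∑ a, μ a • x a = 0) (w : E) :
    ∑ a, μ a * ‖x a - w‖ ^ 2 = ∑ a, μ a * ‖x a‖ ^ 2 := by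
  have h : inner ℝ (∑ a, μ a • x a) w = 0 := by rw [hx, inner_zero_left]
  simp only [sum_inner, real_inner_smul_left] at h
  have : ∀ a, μ a * ‖x a - w‖ ^ 2
      = μ a * ‖x a‖ ^ 2 - 2 * (μ a * inner ℝ (x a) w) + μ a * ‖w‖ ^ 2 := fun a => by
    rw [norm_sub_sq_real]; ring
  simp only [this, Finset.sum_add_distrib, Finset.sum_sub_distrib, ← Finset.mul_sum,
    ← Finset.sum_mul, h, hμ]
  ring

/-- If every row `i` of `D` increases strictly along the cyclic order starting at `i`, then
nonzero weights of total zero pair negatively with some row. -/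
lemma exists_sum_mul_neg_of_cyclic_increasing {n : ℕ} [NeZero n] (D : Fin n → Fin n → ℝ)
    (hD : ∀ i a b, a - i < b - i → D i a < D i b) (μ : Fin n → ℝ) (hμ : ∑ a, μ a = 0)
    (hne : μ ≠ 0) : ∃ i, ∑ a, μ a * D i a < 0 := by
  have hn : 0 < n := Nat.pos_of_neZero n
  obtain ⟨i, hi, hpos⟩ := exists_partial_sums_nonneg_of_periodic hn
    (fun j => μ (Fin.ofNat n j)) (fun j => congrArg μ (Fin.ext (by simp [Fin.ofNat])))
    (by rw [← hμ, ← Fin.sum_univ_eq_sum_range (fun j => μ (Fin.ofNat n j))]; simp)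
  have hcast : ∀ k : Fin n, Fin.ofNat n (i + k) = ⟨i, hi⟩ + k := fun k => by
    ext; simp [Fin.val_add]
  have hshift : ∀ f : Fin n → ℝ,
      ∑ j ∈ Finset.range n, f (Fin.ofNat n (i + j)) = ∑ a, f a := fun f => by
    rw [← Fin.sum_univ_eq_sum_range (fun j => f (Fin.ofNat n (i + j)))]
    simp only [hcast]
    exact Equiv.sum_comp (Equiv.addLeft (⟨i, hi⟩ : Fin n)) f
  refine ⟨⟨i, hi⟩, ?_⟩
  by_contra! hsum
  refine hne (funext fun a => ?_)
  have hzero := eq_zero_of_sum_mul_nonneg_of_partial_sums_nonneg n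
    (fun j => μ (Fin.ofNat n (i + j))) (fun j => D ⟨i, hi⟩ (Fin.ofNat n (i + j)))
    (fun k hk => hD _ _ _ ?_) hpos ((hshift μ).trans hμ)
    (by
      rw [hshift (fun a => D ⟨i, hi⟩ a * μ a)]
      simpa only [mul_comm] using hsum)
    (a - ⟨i, hi⟩ : Fin n) (Fin.is_lt _)
  · simpa only [hcast, add_sub_cancel, Pi.zero_apply] using hzero
  · have h₁ := hcast ⟨k, by omega⟩
    have h₂ := hcast ⟨k + 1, hk⟩
    simp only at h₁ h₂
    rw [h₁, h₂, add_sub_cancel_left, add_sub_cancel_left]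
    simp [Fin.lt_def]

/-- The cyclic profile of `d + 2` rankings of `d + 2` alternatives is not Euclidean in
dimension `d`. -/
lemma not_euclidean_cyclic {E : Type*} [NormedAddCommGroup E] [InnerProductSpace ℝ E]
    [FiniteDimensional ℝ E] {n : ℕ} [NeZero n] (hn : Module.finrank ℝ E + 1 < n)
    (x w : Fin n → E) : ¬ ∀ i a b, a - i < b - i → ‖x a - w i‖ < ‖x b - w i‖ := by
  intro hxw
  have hdep : ¬ AffineIndependent ℝ x := fun h => by
    have := h.card_le_finrank_succ
    have := Submodule.finrank_le (vectorSpan ℝ (Set.range x))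
    simp only [Fintype.card_fin] at *
    omega
  simp only [affineIndependent_iff_of_fintype, not_forall] at hdep
  obtain ⟨μ, hμ, hx, a, ha⟩ := hdep
  rw [Finset.univ.weightedVSub_eq_linear_combination hμ] at hx
  have hD : ∀ i a b, a - i < b - i → ‖x a - w i‖ ^ 2 < ‖x b - w i‖ ^ 2 := fun i a b h => by
    have := hxw i a b h
    gcongr
  have hne : μ ≠ 0 := fun h => ha (by simp [h])
  obtain ⟨i, hi⟩ := exists_sum_mul_neg_of_cyclic_increasing _ hD μ hμ hne
  obtain ⟨j, hj⟩ := exists_sum_mul_neg_of_cyclic_increasing _ hD (-μ) (by simp [hμ])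
    (neg_ne_zero.2 hne)
  simp only [Pi.neg_apply, neg_mul, Finset.sum_neg_distrib] at hj
  rw [sum_mul_norm_sub_sq_of_sum_smul_eq_zero μ x hμ hx] at hi hj
  linarith


/-- For all positive integers `I`, `A`, `d` with `d < min (I-1) (A-1)`, there exists
a profile of `I` preferences (rankings, i.e. permutations of `Fin A`, where individual
`i` prefers `a` to `b` iff `P i a < P i b`) over `A` alternatives that is not
`d`-Euclidean. -/
theorem exists_not_euclidean
    (I A d : ℕ) (hI : 0 < I) (hA : 0 < A) (hd : 0 < d)
    (h : d < min (I - 1) (A - 1)) :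
    ∃ P : Fin I → Equiv.Perm (Fin A),
      ¬ ∃ (x : Fin A → EuclideanSpace ℝ (Fin d)) (w : Fin I → EuclideanSpace ℝ (Fin d)),
        ∀ (i : Fin I) (a b : Fin A),
          (P i) a < (P i) b ↔ ‖x a - w i‖ < ‖x b - w i‖ := by
  have hnA : d + 2 ≤ A := by omega
  have hnI : d + 2 ≤ I := by omega
  refine ⟨fun i => Equiv.Perm.viaFintypeEmbedding
    (Equiv.subRight (Fin.ofNat (d + 2) i)) (Fin.castLEEmb hnA), ?_⟩
  rintro ⟨x, w, hxw⟩
  refine not_euclidean_cyclic (n := d + 2) (by simp) (fun a => x (Fin.castLEEmb hnA a))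
    (fun i => w (Fin.castLE hnI i)) fun i a b hab => (hxw _ _ _).1 ?_
  simp only [Equiv.Perm.viaFintypeEmbedding_apply_image]
  simpa using hab
end

section
/- For all positive integers I, A, d with d ≥ A − 1, every profile of I preferences over A alternatives is d-Euclidean. -/
/-- If `n ≤ d`, there are `n + 1` points of `d`-dimensional Euclidean space (the origin and `n`
standard basis vectors) such that the squared distances from them to some point can be
prescribed arbitrarily up to a common additive constant. -/
theorem exists_points_norm_sub_sq_eq {n d : ℕ} (h : n ≤ d) :
    ∃ x : Fin (n + 1) → EuclideanSpace ℝ (Fin d), ∀ r : Fin (n + 1) → ℝ,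
      ∃ w : EuclideanSpace ℝ (Fin d), ∀ a, ‖x a - w‖ ^ 2 = ‖w‖ ^ 2 + (r a - r 0) := by
  refine ⟨Fin.cons 0 (fun j => EuclideanSpace.single (Fin.castLE h j) 1), fun r =>
    ⟨WithLp.toLp 2 (Function.extend (Fin.castLE h)
      (fun j => (1 - (r j.succ - r 0)) / 2) 0), fun a => ?_⟩⟩
  cases a using Fin.cases with
  | zero => simp
  | succ j =>
    rw [Fin.cons_succ, norm_sub_sq_real, EuclideanSpace.inner_single_left]
    simp only [PiLp.norm_single, (Fin.castLE_injective h).extend_apply]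
    simp
    ring

/-- For all positive integers `I`, `A`, `d` with `d ≥ A - 1`, every profile of `I`
preferences (rankings, i.e. permutations of `Fin A`, where individual `i` prefers
`a` to `b` iff `P i a < P i b`) over `A` alternatives is `d`-Euclidean. -/
theorem euclidean_of_dim_ge_alternatives
    (I A d : ℕ) (hI : 0 < I) (hA : 0 < A) (hd : 0 < d)
    (h : A - 1 ≤ d) :
    ∀ P : Fin I → Equiv.Perm (Fin A),
      ∃ (x : Fin A → EuclideanSpace ℝ (Fin d)) (w : Fin I → EuclideanSpace ℝ (Fin d)),
        ∀ (i : Fin I) (a b : Fin A),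
          (P i) a < (P i) b ↔ ‖x a - w i‖ < ‖x b - w i‖ := by
  intro P
  obtain ⟨n, rfl⟩ := Nat.exists_eq_succ_of_ne_zero hA.ne'
  obtain ⟨x, hx⟩ := exists_points_norm_sub_sq_eq (n := n) h
  choose w hw using fun i => hx (fun a => ((P i a : ℕ) : ℝ))
  refine ⟨x, w, fun i a b => ?_⟩
  rw [← sq_lt_sq₀ (norm_nonneg _) (norm_nonneg _), hw, hw]
  simp
end

section
/- For all positive integers I, A, d with d ≥ I, every profile of I preferences over A alternatives is d-Euclidean. -/
/-- Any finite family of points in a real inner product space is, seen from a point far enough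
away in the direction of `e`, ordered by decreasing inner product with `e`. -/
theorem exists_forall_inner_lt_imp_norm_sub_smul_lt {E α : Type*} [NormedAddCommGroup E]
    [InnerProductSpace ℝ E] [Finite α] (x : α → E) (e : E) :
    ∃ t : ℝ, ∀ a b : α, inner ℝ (x b) e < inner ℝ (x a) e → ‖x a - t • e‖ < ‖x b - t • e‖ := by
  have key : ∀ a b : α, ∀ᶠ t : ℝ in Filter.atTop,
      inner ℝ (x b) e < inner ℝ (x a) e → ‖x a - t • e‖ < ‖x b - t • e‖ := by
    intro a b
    by_cases hab : inner ℝ (x b) e < inner ℝ (x a) e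
    · have hlim : Filter.Tendsto (fun t : ℝ => t * (2 * (inner ℝ (x a) e - inner ℝ (x b) e)))
          Filter.atTop Filter.atTop :=
        Filter.tendsto_id.atTop_mul_const (by linarith)
      filter_upwards [hlim.eventually_gt_atTop (‖x a‖ ^ 2 - ‖x b‖ ^ 2)] with t ht _
      refine lt_of_pow_lt_pow_left₀ 2 (norm_nonneg _) ?_
      rw [norm_sub_sq_real, norm_sub_sq_real, real_inner_smul_right, real_inner_smul_right]
      linarith
    · exact Filter.Eventually.of_forall fun t h => absurd h hab
  exact (Filter.eventually_all.2 fun a => Filter.eventually_all.2 (key a)).exists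

/-- For all positive integers `I`, `A`, `d` with `d ≥ I`, every profile of `I`
preferences (rankings, i.e. permutations of `Fin A`, where individual `i` prefers
`a` to `b` iff `P i a < P i b`) over `A` alternatives is `d`-Euclidean. -/
theorem euclidean_of_dim_ge_individuals
    (I A d : ℕ) (hI : 0 < I) (hA : 0 < A) (hd : 0 < d)
    (h : I ≤ d) :
    ∀ P : Fin I → Equiv.Perm (Fin A),
      ∃ (x : Fin A → EuclideanSpace ℝ (Fin d)) (w : Fin I → EuclideanSpace ℝ (Fin d)),
        ∀ (i : Fin I) (a b : Fin A),
          (P i) a < (P i) b ↔ ‖x a - w i‖ < ‖x b - w i‖ := by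
  intro P
  let x : Fin A → EuclideanSpace ℝ (Fin d) := fun a =>
    WithLp.toLp 2 fun k => if hk : k.val < I then -((P ⟨k, hk⟩ a).val : ℝ) else 0
  let e : Fin I → EuclideanSpace ℝ (Fin d) := fun i => EuclideanSpace.single (Fin.castLE h i) 1
  have hx : ∀ i a, inner ℝ (x a) (e i) = -((P i a).val : ℝ) := by
    intro i a
    simp [x, e, EuclideanSpace.inner_single_right]
  choose t ht using fun i => exists_forall_inner_lt_imp_norm_sub_smul_lt x (e i)
  have hlt : ∀ i a b, P i a < P i b → ‖x a - t i • e i‖ < ‖x b - t i • e i‖ := by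
    intro i a b hab
    apply ht
    rw [hx, hx, neg_lt_neg_iff]
    exact_mod_cast hab
  refine ⟨x, fun i => t i • e i, fun i a b => ⟨hlt i a b, fun hn => ?_⟩⟩
  rcases lt_trichotomy (P i a) (P i b) with hab | hab | hab
  · exact hab
  · rw [(P i).injective hab] at hn
    exact absurd hn (lt_irrefl _)
  · exact absurd hn (hlt i b a hab).not_gt
end

section
/- Let A and d be positive integers with 1 ≤ d ≤ A − 2, and let σ be a permutation of {1,…,A}, viewed as a ranking of the alternatives 1,…,A with pos_σ(n) the rank of alternative n. The following are equivalent: (i) there exists a (d+2)-element subset T ⊆ {1,…,A} such that σ ranks the minimum element of T above every other element of T; (ii) there exists n ∈ {1,…,A−d−1} such that pos_σ(n) ≤ A − d − n. -/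
/-- The alternatives with a larger index than `n` that `σ` ranks below `n`. -/
def dominatedBy {A : ℕ} (σ : Equiv.Perm (Fin A)) (n : Fin A) : Finset (Fin A) :=
  Finset.univ.filter fun b => n < b ∧ σ n < σ b

theorem mem_dominatedBy {A : ℕ} {σ : Equiv.Perm (Fin A)} {n b : Fin A} :
    b ∈ dominatedBy σ n ↔ n < b ∧ σ n < σ b := by
  simp [dominatedBy]

theorem dominatedBy_subset {A : ℕ} {σ : Equiv.Perm (Fin A)} {n b : Fin A}
    (h : b ∈ dominatedBy σ n) : dominatedBy σ b ⊆ dominatedBy σ n := by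
  intro c hc
  rw [mem_dominatedBy] at *
  exact ⟨h.1.trans hc.1, h.2.trans hc.2⟩

theorem card_ranked_above {A : ℕ} (σ : Equiv.Perm (Fin A)) (n : Fin A) :
    ((Finset.Iio (σ n)).map σ.symm.toEmbedding).card = σ n := by
  simp

theorem mem_ranked_above {A : ℕ} {σ : Equiv.Perm (Fin A)} {n b : Fin A} :
    b ∈ (Finset.Iio (σ n)).map σ.symm.toEmbedding ↔ σ b < σ n := by
  simp

theorem le_card_dominatedBy {A : ℕ} (σ : Equiv.Perm (Fin A)) (n : Fin A) :
    A ≤ n + σ n + 1 + (dominatedBy σ n).card := by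
  have hcover : (Finset.univ : Finset (Fin A)) ⊆
      ((Finset.Iio n ∪ (Finset.Iio (σ n)).map σ.symm.toEmbedding) ∪ {n}) ∪
        dominatedBy σ n := by
    intro b _
    have hinj : σ b = σ n → b = n := fun h => σ.injective h
    simp only [Finset.mem_union, mem_ranked_above, mem_dominatedBy, Finset.mem_Iio,
      Finset.mem_singleton]
    grind
  have hcard := Finset.card_le_card hcover
  have h₁ := Finset.card_union_le
    ((Finset.Iio n ∪ (Finset.Iio (σ n)).map σ.symm.toEmbedding) ∪ {n}) (dominatedBy σ n)
  have h₂ := Finset.card_union_le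
    (Finset.Iio n ∪ (Finset.Iio (σ n)).map σ.symm.toEmbedding) {n}
  have h₃ := Finset.card_union_le (Finset.Iio n) ((Finset.Iio (σ n)).map σ.symm.toEmbedding)
  rw [card_ranked_above, Fin.card_Iio] at h₃
  rw [Finset.card_singleton] at h₂
  rw [Finset.card_univ, Fintype.card_fin] at hcard
  omega

theorem card_dominatedBy_le {A : ℕ} (σ : Equiv.Perm (Fin A)) (n : Fin A)
    (hn : ∀ b, n ∉ dominatedBy σ b) :
    n + σ n + 1 + (dominatedBy σ n).card ≤ A := by
  simp only [mem_dominatedBy, not_and, not_lt] at hn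
  have h₃ : Disjoint (Finset.Iio n) ((Finset.Iio (σ n)).map σ.symm.toEmbedding) := by
    rw [Finset.disjoint_left]
    intro b hb hb'
    rw [mem_ranked_above] at hb'
    exact (hn b (Finset.mem_Iio.1 hb)).not_gt hb'
  have h₂ : Disjoint (Finset.Iio n ∪ (Finset.Iio (σ n)).map σ.symm.toEmbedding) {n} := by
    rw [Finset.disjoint_singleton_right, Finset.mem_union, mem_ranked_above]
    simp
  have h₁ : Disjoint ((Finset.Iio n ∪ (Finset.Iio (σ n)).map σ.symm.toEmbedding) ∪ {n})
      (dominatedBy σ n) := by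
    rw [Finset.disjoint_left]
    intro b
    simp only [Finset.mem_union, mem_ranked_above, mem_dominatedBy, Finset.mem_Iio,
      Finset.mem_singleton]
    grind
  have hcard := Finset.card_le_univ
    (((Finset.Iio n ∪ (Finset.Iio (σ n)).map σ.symm.toEmbedding) ∪ {n}) ∪ dominatedBy σ n)
  rwa [Finset.card_union_of_disjoint h₁, Finset.card_union_of_disjoint h₂,
    Finset.card_union_of_disjoint h₃, card_ranked_above, Fin.card_Iio,
    Finset.card_singleton, Fintype.card_fin] at hcard

/-- Let `1 ≤ d ≤ A - 2` and let `σ` be a permutation of the alternatives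
(`Fin A`, where alternative `n : Fin A` stands for the 1-indexed alternative `n + 1`),
viewed as a ranking with 1-indexed rank `pos_σ(n) = σ n + 1` (so `σ` ranks `a` above
`b` iff `σ a < σ b`).  The following are equivalent:
(i) there is a `(d+2)`-element subset `T` of the alternatives such that `σ` ranks the
minimum element of `T` above every other element of `T`;
(ii) there is an alternative `n` with 1-index `(n : ℕ) + 1 ≤ A - d - 1` and
`pos_σ(n) = (σ n : ℕ) + 1 ≤ A - d - ((n : ℕ) + 1)`. -/
theorem min_top_subset_iff_low_index_high_rank
    (A d : ℕ) (hd : 1 ≤ d) (hdA : d ≤ A - 2) (σ : Equiv.Perm (Fin A)) :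
    (∃ T : Finset (Fin A), T.card = d + 2 ∧
        ∃ a ∈ T, (∀ b ∈ T, a ≤ b) ∧ ∀ b ∈ T, b ≠ a → σ a < σ b)
    ↔ ∃ n : Fin A, (n : ℕ) + 1 ≤ A - d - 1 ∧ ((σ n : ℕ) + 1 ≤ A - d - ((n : ℕ) + 1)) := by
  constructor
  · rintro ⟨T, hT, a, ha, hmin, htop⟩
    have hsub : T.erase a ⊆ dominatedBy σ a := by
      intro b hb
      rw [Finset.mem_erase] at hb
      exact mem_dominatedBy.2 ⟨lt_of_le_of_ne (hmin b hb.2) hb.1.symm, htop b hb.2 hb.1⟩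
    have hcard : d + 1 ≤ (dominatedBy σ a).card := by
      have h := Finset.card_le_card hsub
      rw [Finset.card_erase_of_mem ha] at h
      omega
    obtain ⟨n, hn, hn_min⟩ := WellFounded.has_min (wellFounded_lt (α := Fin A))
      {n | d + 1 ≤ (dominatedBy σ n).card} ⟨a, hcard⟩
    have hle := card_dominatedBy_le σ n fun b hb =>
      hn_min b (hn.trans (Finset.card_le_card (dominatedBy_subset hb))) (mem_dominatedBy.1 hb).1
    rw [Set.mem_ofPred_eq] at hn
    exact ⟨n, by omega, by omega⟩
  · rintro ⟨n, -, hn⟩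
    have hle := le_card_dominatedBy σ n
    obtain ⟨S, hS, hScard⟩ := Finset.exists_subset_card_eq
      (show d + 1 ≤ (dominatedBy σ n).card by omega)
    have hlt : ∀ b ∈ S, n < b ∧ σ n < σ b := fun b hb => mem_dominatedBy.1 (hS hb)
    refine ⟨insert n S, ?_, n, Finset.mem_insert_self n S, ?_, ?_⟩
    · rw [Finset.card_insert_of_notMem fun h => lt_irrefl _ (hlt n h).1, hScard]
    · intro b hb
      rcases Finset.mem_insert.1 hb with rfl | hb
      · exact le_rfl
      · exact (hlt b hb).1.le
    · intro b hb hne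
      exact (hlt b (Finset.mem_of_mem_insert_of_ne hb hne)).2
end

section
/- Let A and d be positive integers with 1 ≤ d ≤ A − 2, and let S be a set of distinct permutations of {1,…,A} such that the profile whose individuals are exactly the members of S is d-Euclidean. Then |S| ≤ #{σ a permutation of {1,…,A} : pos_σ(n) > A − d − n for all n ∈ {1,…,A−d−1}}; that is, the maximum number r of preferences over A alternatives that are simultaneously representable in a d-dimensional Euclidean model satisfies r ≤ (1 − P(C_pref)) · A!, where P(C_pref) is the proportion of permutations σ with pos_σ(n) ≤ A − d − n for some n ∈ {1,…,A−d−1}. -/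
open Finset
open scoped Classical

noncomputable section

/-- Upper bound for the number of strict orders induced by `n` affine functions on a
`d`-dimensional real vector space: the sum of the `d + 1` leading unsigned Stirling numbers
of the first kind. -/
def orderBound : ℕ → ℕ → ℕ
  | 0, _ => 1
  | _ + 1, 0 => 1
  | n + 1, d + 1 => orderBound n (d + 1) + n * orderBound n d

theorem orderBound_pos (n d : ℕ) : 0 < orderBound n d := by
  induction n generalizing d with
  | zero => simp [orderBound]
  | succ n ih => cases d <;> simp [orderBound, ih]

theorem orderBound_le_succ (n d : ℕ) : orderBound n d ≤ orderBound n (d + 1) := by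
  induction n generalizing d with
  | zero => simp [orderBound]
  | succ n ih =>
    cases d with
    | zero =>
      simp only [orderBound]
      exact le_add_right (orderBound_pos n 1)
    | succ d =>
      simp only [orderBound]
      gcongr <;> exact ih _

theorem orderBound_le_factorial (n d : ℕ) : orderBound n d ≤ n.factorial := by
  induction n generalizing d with
  | zero => simp [orderBound]
  | succ n ih =>
    cases d with
    | zero => exact Nat.succ_le_of_lt (Nat.factorial_pos _)
    | succ d =>
      rw [orderBound, Nat.factorial_succ]
      nlinarith [ih (d + 1), Nat.mul_le_mul_left n (ih d)]

theorem mul_orderBound_le {n d : ℕ} (h : d + 2 ≤ n) :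
    n * orderBound n d ≤ (d + 1) * orderBound n (d + 1) := by
  induction n generalizing d with
  | zero => omega
  | succ n ih =>
    have hmono := orderBound_le_succ n d
    cases d with
    | zero =>
      have h1 := orderBound_pos n 1
      have h0 : orderBound n 0 = 1 := by cases n <;> rfl
      simp only [orderBound, h0]
      omega
    | succ d =>
      have hprev : n * orderBound n d ≤ (d + 1) * orderBound n (d + 1) := ih (by omega)
      simp only [orderBound]
      calc (n + 1) * (orderBound n (d + 1) + n * orderBound n d)
          ≤ (n + 1) * (orderBound n (d + 1) + (d + 1) * orderBound n (d + 1)) := by gcongr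
        _ = (d + 1 + 1) * (orderBound n (d + 1) + n * orderBound n (d + 1)) := by ring
        _ ≤ _ := by gcongr

theorem orderBound_succ_le {n d : ℕ} (h : d + 1 ≤ n) :
    orderBound (n + 1) d ≤ (d + 1) * orderBound n d := by
  cases d with
  | zero => simpa [orderBound] using Nat.succ_le_of_lt (orderBound_pos n 0)
  | succ d =>
    have := mul_orderBound_le h
    rw [orderBound]
    linarith

/-- The strict orders on `Fin n` induced by the values of the affine functions `L i + c i`
at the points where these values are pairwise distinct. -/
def inducedOrders {n : ℕ} {V : Type*} [AddCommGroup V] [Module ℝ V]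
    (L : Fin n → Module.Dual ℝ V) (c : Fin n → ℝ) : Set (Fin n → Fin n → Prop) :=
  {r | ∃ v : V, Function.Injective (fun i => L i v + c i) ∧
    r = fun i j => L i v + c i < L j v + c j}

/-- The relation on `Fin n` obtained by removing `0` from `Fin (n + 1)`. -/
def removeZero {n : ℕ} (r : Fin (n + 1) → Fin (n + 1) → Prop) : Fin n → Fin n → Prop :=
  fun i j => r i.succ j.succ

theorem removeZero_mem_inducedOrders {n : ℕ} {V : Type*} [AddCommGroup V] [Module ℝ V]
    {L : Fin (n + 1) → Module.Dual ℝ V} {c : Fin (n + 1) → ℝ}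
    {r : Fin (n + 1) → Fin (n + 1) → Prop} (hr : r ∈ inducedOrders L c) :
    removeZero r ∈ inducedOrders (fun i => L i.succ) (fun i => c i.succ) := by
  obtain ⟨v, hv, rfl⟩ := hr
  exact ⟨v, hv.comp (Fin.succ_injective n), rfl⟩

theorem inducedOrders_ext {n : ℕ} {V : Type*} [AddCommGroup V] [Module ℝ V]
    {L : Fin (n + 1) → Module.Dual ℝ V} {c : Fin (n + 1) → ℝ}
    {r s : Fin (n + 1) → Fin (n + 1) → Prop}
    (hr : r ∈ inducedOrders L c) (hs : s ∈ inducedOrders L c)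
    (hrs : removeZero r = removeZero s) (h0 : ∀ i : Fin n, r i.succ 0 ↔ s i.succ 0) :
    r = s := by
  have flip : ∀ t ∈ inducedOrders L c, ¬ t 0 0 ∧ ∀ i : Fin n, t 0 i.succ ↔ ¬ t i.succ 0 := by
    rintro _ ⟨v, hv, rfl⟩
    refine ⟨lt_irrefl _, fun i => ?_⟩
    have : L 0 v + c 0 ≠ L i.succ v + c i.succ := fun h => (Fin.succ_ne_zero i) (hv h).symm
    rw [not_lt]
    exact ⟨le_of_lt, fun h => lt_of_le_of_ne h this⟩
  ext i j
  cases i using Fin.cases with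
  | zero =>
    cases j using Fin.cases with
    | zero => simp [(flip r hr).1, (flip s hs).1]
    | succ j => rw [(flip r hr).2, (flip s hs).2, h0]
  | succ i =>
    cases j using Fin.cases with
    | zero => exact h0 i
    | succ j => exact iff_of_eq (congrFun (congrFun hrs i) j)

/-- The orders in `inducedOrders L c` in which `j.succ` is the immediate predecessor of `0`, and
whose restriction to the nonzero indices also extends to an order with `0` below `j.succ`. -/
def crossingOrders {n : ℕ} {V : Type*} [AddCommGroup V] [Module ℝ V]
    (L : Fin (n + 1) → Module.Dual ℝ V) (c : Fin (n + 1) → ℝ) (j : Fin n) :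
    Set (Fin (n + 1) → Fin (n + 1) → Prop) :=
  {r ∈ inducedOrders L c | (∀ i : Fin n, r i.succ 0 ↔ ¬ r j.succ i.succ) ∧
    ∃ s ∈ inducedOrders L c, removeZero s = removeZero r ∧ ¬ s j.succ 0}

/-- The orders in `inducedOrders L c` in which `0` is placed as low as possible, given the order of
the nonzero indices. -/
def lowestOrders {n : ℕ} {V : Type*} [AddCommGroup V] [Module ℝ V]
    (L : Fin (n + 1) → Module.Dual ℝ V) (c : Fin (n + 1) → ℝ) :
    Set (Fin (n + 1) → Fin (n + 1) → Prop) :=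
  {r ∈ inducedOrders L c | ∀ s ∈ inducedOrders L c, removeZero s = removeZero r →
    ∀ i : Fin n, r i.succ 0 → s i.succ 0}

theorem ncard_lowestOrders_le {n : ℕ} {V : Type*} [AddCommGroup V] [Module ℝ V]
    (L : Fin (n + 1) → Module.Dual ℝ V) (c : Fin (n + 1) → ℝ) :
    (lowestOrders L c).ncard ≤
      (inducedOrders (fun i : Fin n => L i.succ) (fun i => c i.succ)).ncard := by
  refine Set.ncard_le_ncard_of_injOn removeZero
    (fun r hr => removeZero_mem_inducedOrders hr.1) ?_ (Set.toFinite _)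
  intro r hr s hs hrs
  exact inducedOrders_ext hr.1 hs.1 hrs fun i =>
    ⟨hr.2 s hs.1 hrs.symm i, hs.2 r hr.1 hrs i⟩

theorem inducedOrders_subset {n : ℕ} {V : Type*} [AddCommGroup V] [Module ℝ V]
    (L : Fin (n + 1) → Module.Dual ℝ V) (c : Fin (n + 1) → ℝ) :
    inducedOrders L c ⊆
      lowestOrders L c ∪ ⋃ j ∈ (univ : Finset (Fin n)), crossingOrders L c j := by
  intro r hr
  by_cases hlow : r ∈ lowestOrders L c
  · exact Or.inl hlow
  right
  simp only [mem_univ, Set.iUnion_true, Set.mem_iUnion]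
  have hex : ∃ s ∈ inducedOrders L c, removeZero s = removeZero r ∧
      ∃ i : Fin n, r i.succ 0 ∧ ¬ s i.succ 0 := by
    by_contra! h
    exact hlow ⟨hr, fun s hs hsr i => h s hs hsr i⟩
  obtain ⟨s, hs, hsr, i, hri, hsi⟩ := hex
  obtain ⟨v, hv, rfl⟩ := id hr
  obtain ⟨j, hj, hmax⟩ := exists_max_image
    (univ.filter fun k : Fin n => L k.succ v + c k.succ < L 0 v + c 0)
    (fun k => L k.succ v + c k.succ) ⟨i, by simpa using hri⟩
  simp only [mem_filter, mem_univ, true_and] at hj hmax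
  refine ⟨j, hr, fun k => ⟨fun hk => not_lt.2 (hmax k hk), fun hk => (not_lt.1 hk).trans_lt hj⟩,
    s, hs, hsr, fun hsj => hsi ?_⟩
  have hij : i = j ∨ s i.succ j.succ := by
    rcases eq_or_ne i j with h | h
    · exact Or.inl h
    · refine Or.inr ((iff_of_eq (congrFun (congrFun hsr i) j)).2
        (lt_of_le_of_ne (hmax i hri) fun he => h (Fin.succ_injective n (hv he))))
  obtain ⟨w, hw, rfl⟩ := hs
  rcases hij with rfl | hij
  · exact hsj
  · exact lt_trans hij hsj

/-- If the same strict order of the nonzero indices is induced at a point `v` where `0` lies above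
`j.succ` and at a point `w` where it does not, then it is induced at a point where the two are
tied. -/
theorem exists_tie {n : ℕ} {V : Type*} [AddCommGroup V] [Module ℝ V]
    (L : Fin (n + 1) → Module.Dual ℝ V) (c : Fin (n + 1) → ℝ) (j : Fin n) {v w : V}
    (hv : Function.Injective fun i : Fin n => L i.succ v + c i.succ)
    (hvw : ∀ i k : Fin n, L i.succ v + c i.succ < L k.succ v + c k.succ ↔
      L i.succ w + c i.succ < L k.succ w + c k.succ)
    (hjv : L j.succ v + c j.succ < L 0 v + c 0) (hjw : L 0 w + c 0 ≤ L j.succ w + c j.succ) :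
    ∃ u : V, L 0 u + c 0 = L j.succ u + c j.succ ∧
      ∀ i k : Fin n, i ≠ k → (L i.succ v + c i.succ < L k.succ v + c k.succ ↔
        L i.succ u + c i.succ < L k.succ u + c k.succ) := by
  set a := L 0 v + c 0 - (L j.succ v + c j.succ) with ha
  set b := L j.succ w + c j.succ - (L 0 w + c 0) with hb
  have ha0 : 0 < a := by linarith
  have hb0 : 0 ≤ b := by linarith
  have hab : 0 < a + b := by linarith
  set t := a / (a + b) with ht
  set t' := b / (a + b) with ht'
  have ht0 : 0 < t := by positivity
  have ht0' : 0 ≤ t' := by positivity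
  have hsum : t' + t = 1 := by rw [ht, ht']; field_simp; ring
  have hbal : t' * a = t * b := by rw [ht, ht']; ring
  have hval : ∀ i, L i (t' • v + t • w) + c i = t' * (L i v + c i) + t * (L i w + c i) := by
    intro i
    simp only [map_add, map_smul, smul_eq_mul]
    linear_combination (-c i) * hsum
  have hkey : ∀ i k : Fin n, L i.succ v + c i.succ < L k.succ v + c k.succ →
      L i.succ (t' • v + t • w) + c i.succ < L k.succ (t' • v + t • w) + c k.succ := by
    intro i k h
    have h' := (hvw i k).1 h
    rw [hval, hval]
    exact add_lt_add_of_le_of_lt (mul_le_mul_of_nonneg_left h.le ht0')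
      (mul_lt_mul_of_pos_left h' ht0)
  refine ⟨t' • v + t • w, ?_, fun i k hik => ⟨hkey i k, fun h => ?_⟩⟩
  · rw [hval, hval]
    linear_combination hbal
  · by_contra hcon
    exact lt_asymm h (hkey k i (lt_of_le_of_ne (not_lt.1 hcon) fun he => hik (hv he).symm))

theorem ncard_crossingOrders_le {n d : ℕ} {V : Type*} [AddCommGroup V] [Module ℝ V]
    (hV : Module.finrank ℝ V = d + 1)
    (L : Fin (n + 1) → Module.Dual ℝ V) (c : Fin (n + 1) → ℝ) (j : Fin n) {m : ℕ}
    (hm : ∀ (K : Submodule ℝ V), Module.finrank ℝ K = d →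
      ∀ (M : Fin n → Module.Dual ℝ K) (e : Fin n → ℝ), (inducedOrders M e).ncard ≤ m) :
    (crossingOrders L c j).ncard ≤ m := by
  have : FiniteDimensional ℝ V := FiniteDimensional.of_finrank_pos (by omega)
  rcases (crossingOrders L c j).eq_empty_or_nonempty with hempty | ⟨r, hr⟩
  · simp [hempty]
  have htie : ∀ r ∈ crossingOrders L c j, ∃ u : V, L 0 u + c 0 = L j.succ u + c j.succ ∧
      Function.Injective (fun i : Fin n => L i.succ u + c i.succ) ∧
      removeZero r = fun i k => L i.succ u + c i.succ < L k.succ u + c k.succ := by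
    rintro _ ⟨⟨v, hv, rfl⟩, hpred, s, ⟨w, hw, rfl⟩, hsr, hsj⟩
    have hinj := hv.comp (Fin.succ_injective n)
    obtain ⟨u, hu, huv⟩ := exists_tie L c j hinj
      (fun i k => (iff_of_eq (congrFun (congrFun hsr i) k)).symm)
      ((hpred j).2 (lt_irrefl _)) (not_lt.1 hsj)
    refine ⟨u, hu, fun i k hik => ?_, ?_⟩
    · by_contra hne
      rcases lt_or_gt_of_ne (hinj.ne hne) with h | h
      · exact ((huv i k hne).1 h).ne hik
      · exact ((huv k i (Ne.symm hne)).1 h).ne' hik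
    · ext i k
      rcases eq_or_ne i k with rfl | hne
      · simp [removeZero]
      · exact huv i k hne
  set g : Module.Dual ℝ V := L 0 - L j.succ with hg
  have hg0 : g ≠ 0 := by
    intro h0
    obtain ⟨u, hu, -⟩ := htie r hr
    obtain ⟨⟨v, hv, rfl⟩, hpred, -⟩ := hr
    have hlt : L j.succ v + c j.succ < L 0 v + c 0 := (hpred j).2 (lt_irrefl _)
    have h1 : L 0 u - L j.succ u = 0 := by simpa [hg] using LinearMap.congr_fun h0 u
    have h2 : L 0 v - L j.succ v = 0 := by simpa [hg] using LinearMap.congr_fun h0 v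
    linarith
  obtain ⟨p, hp, -⟩ := htie r hr
  have hfin : Module.finrank ℝ (LinearMap.ker g) = d := by
    have := Module.Dual.finrank_ker_add_one_of_ne_zero hg0
    omega
  refine le_trans (Set.ncard_le_ncard_of_injOn removeZero (fun r hr => ?_) ?_ (Set.toFinite _))
    (hm (LinearMap.ker g) hfin (fun i => (L i.succ).comp (LinearMap.ker g).subtype)
      (fun i => L i.succ p + c i.succ))
  · obtain ⟨u, hu, huinj, hru⟩ := htie r hr
    have hker : u - p ∈ LinearMap.ker g := by
      simp only [LinearMap.mem_ker, hg, LinearMap.sub_apply, map_sub]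
      linarith
    have hval : ∀ i : Fin n, ((L i.succ).comp (LinearMap.ker g).subtype) ⟨u - p, hker⟩ +
        (L i.succ p + c i.succ) = L i.succ u + c i.succ := by
      intro i
      simp only [LinearMap.comp_apply, Submodule.subtype_apply, map_sub]
      ring
    refine ⟨⟨u - p, hker⟩, ?_, ?_⟩
    · simpa only [hval] using huinj
    · simpa only [hval] using hru
  · intro r hr s hs hrs
    refine inducedOrders_ext hr.1 hs.1 hrs fun i => ?_
    rw [hr.2.1, hs.2.1, not_iff_not]
    exact iff_of_eq (congrFun (congrFun hrs j) i)

theorem ncard_inducedOrders_le {n d : ℕ} {V : Type*} [AddCommGroup V] [Module ℝ V]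
    [FiniteDimensional ℝ V] (hV : Module.finrank ℝ V = d)
    (L : Fin n → Module.Dual ℝ V) (c : Fin n → ℝ) :
    (inducedOrders L c).ncard ≤ orderBound n d := by
  induction n generalizing d V with
  | zero =>
    exact (Set.ncard_le_one (Set.toFinite _)).2 fun r _ s _ => Subsingleton.elim r s
  | succ n ih =>
    cases d with
    | zero =>
      have : Subsingleton V := Module.finrank_zero_iff.1 hV
      refine (Set.ncard_le_one (Set.toFinite _)).2 ?_
      rintro _ ⟨v, -, rfl⟩ _ ⟨w, -, rfl⟩
      rw [Subsingleton.elim v w]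
    | succ d =>
      calc (inducedOrders L c).ncard
          ≤ (lowestOrders L c ∪ ⋃ j ∈ (univ : Finset (Fin n)), crossingOrders L c j).ncard :=
            Set.ncard_le_ncard (inducedOrders_subset L c) (Set.toFinite _)
        _ ≤ (lowestOrders L c).ncard + ∑ j : Fin n, (crossingOrders L c j).ncard :=
            (Set.ncard_union_le _ _).trans (by gcongr; exact set_ncard_biUnion_le _ _)
        _ ≤ orderBound n (d + 1) + ∑ _j : Fin n, orderBound n d := by
            gcongr with j
            · exact (ncard_lowestOrders_le L c).trans (ih hV _ _)
            · exact ncard_crossingOrders_le hV L c j fun K hK M e => ih hK M e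
        _ = orderBound (n + 1) (d + 1) := by simp [orderBound]

/-- The permutations of `Fin n` which move no element up by more than `d`. -/
def boundedAscent (n d : ℕ) : Finset (Equiv.Perm (Fin n)) :=
  univ.filter fun σ => ∀ k : Fin n, (σ k : ℕ) ≤ d + k

theorem card_boundedAscent_of_le {n d : ℕ} (h : n ≤ d + 1) :
    (boundedAscent n d).card = n.factorial := by
  rw [boundedAscent, filter_true_of_mem fun σ _ k => by omega, card_univ, Fintype.card_perm,
    Fintype.card_fin]

theorem mul_card_boundedAscent_le {n d : ℕ} (h : d ≤ n) :
    (d + 1) * (boundedAscent n d).card ≤ (boundedAscent (n + 1) d).card := by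
  rw [← Fintype.card_fin (d + 1), ← card_univ, ← card_product]
  refine card_le_card_of_injOn
    (fun q => Equiv.Perm.decomposeFin.symm (Fin.castLE (by omega) q.1, q.2)) ?_ ?_
  · rintro ⟨p, σ⟩ hq
    simp only [coe_product, coe_univ, Set.mem_prod, Set.mem_univ, true_and, mem_coe,
      boundedAscent, mem_filter, mem_univ] at hq ⊢
    intro k
    cases k using Fin.cases with
    | zero =>
      rw [Equiv.Perm.decomposeFin_symm_apply_zero]
      simp
      omega
    | succ k =>
      rw [Equiv.Perm.decomposeFin_symm_apply_succ, Equiv.swap_apply_def,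
        if_neg (Fin.succ_ne_zero _)]
      split_ifs
      · simp
      · have := hq k
        simp only [Fin.val_succ]
        omega
  · rintro ⟨p, σ⟩ - ⟨q, τ⟩ - hpq
    have := Equiv.Perm.decomposeFin.symm.injective hpq
    simp only [Prod.mk.injEq] at this
    exact Prod.ext (Fin.castLE_injective _ this.1) this.2

theorem orderBound_le_card_boundedAscent (n d : ℕ) :
    orderBound n d ≤ (boundedAscent n d).card := by
  induction n with
  | zero => simp [orderBound, card_boundedAscent_of_le]
  | succ n ih =>
    rcases Nat.lt_or_ge n (d + 1) with h | h
    · rw [card_boundedAscent_of_le (by omega)]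
      exact orderBound_le_factorial _ _
    · calc orderBound (n + 1) d ≤ (d + 1) * orderBound n d := orderBound_succ_le h
        _ ≤ (d + 1) * (boundedAscent n d).card := by gcongr
        _ ≤ _ := mul_card_boundedAscent_le (by omega)

theorem perm_eq_of_lt_iff {n : ℕ} {σ τ : Equiv.Perm (Fin n)}
    (h : ∀ a b, σ a < σ b ↔ τ a < τ b) : σ = τ := by
  have hmono : StrictMono (τ ∘ σ.symm) := fun a b hab => (h _ _).1 (by simpa using hab)
  have hid : τ ∘ σ.symm = id := (hmono.range_inj strictMono_id).1 (by
    rw [Set.range_id, (τ.surjective.comp σ.symm.surjective).range_eq])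
  ext a
  simpa using congrArg Fin.val (congrFun hid (σ a)).symm

/-- Let `1 ≤ d ≤ A - 2` and let `S` be a set of distinct permutations of the `A`
alternatives (`Fin A`, where `i : Fin A` stands for the 1-indexed alternative `i + 1`,
the 1-indexed rank of alternative `i` under `σ` is `pos_σ(i) = σ i + 1`, and `σ`
prefers `a` to `b` iff `σ a < σ b`) such that the profile whose individuals are
exactly the members of `S` is `d`-Euclidean.  Then the number of preferences in `S`
is at most the number of permutations `σ` with `pos_σ(n) > A - d - n` for every
1-indexed alternative `n ≤ A - d - 1`; i.e. the maximum number of simultaneously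
representable preferences is at most `(1 - P(C_pref)) · A!`. -/
theorem euclidean_card_le_unbanned
    (A d : ℕ) (hd : 1 ≤ d) (hdA : d ≤ A - 2)
    (S : Finset (Equiv.Perm (Fin A)))
    (hS : ∃ (x : Fin A → EuclideanSpace ℝ (Fin d)) (w : S → EuclideanSpace ℝ (Fin d)),
      ∀ (σ : S) (a b : Fin A),
        (σ : Equiv.Perm (Fin A)) a < (σ : Equiv.Perm (Fin A)) b ↔ ‖x a - w σ‖ < ‖x b - w σ‖) :
    S.card ≤ ((univ : Finset (Equiv.Perm (Fin A))).filter (fun σ =>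
      ∀ n : Fin A, (n : ℕ) + 1 ≤ A - d - 1 → A - d - ((n : ℕ) + 1) < (σ n : ℕ) + 1)).card := by
  obtain ⟨x, w, hxw⟩ := hS
  let L : Fin A → Module.Dual ℝ (EuclideanSpace ℝ (Fin d)) :=
    fun a => (-2 : ℝ) • (innerSL ℝ (x a)).toLinearMap
  let c : Fin A → ℝ := fun a => ‖x a‖ ^ 2
  have hval : ∀ a v, L a v + c a = ‖x a - v‖ ^ 2 - ‖v‖ ^ 2 := by
    intro a v
    rw [norm_sub_sq_real]
    simp only [L, c, LinearMap.smul_apply, ContinuousLinearMap.coe_coe, innerSL_apply_apply,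
      smul_eq_mul]
    ring
  have hlt : ∀ (σ : S) a b, (σ : Equiv.Perm (Fin A)) a < (σ : Equiv.Perm (Fin A)) b ↔
      L a (w σ) + c a < L b (w σ) + c b := by
    intro σ a b
    rw [hxw, hval, hval, sub_lt_sub_iff_right,
      pow_lt_pow_iff_left₀ (norm_nonneg _) (norm_nonneg _) two_ne_zero]
  have hcard : S.card ≤ (inducedOrders L c).ncard := by
    rw [← Set.ncard_coe_finset]
    refine Set.ncard_le_ncard_of_injOn (fun σ a b => σ a < σ b) ?_ ?_ (Set.toFinite _)
    · intro σ hσ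
      refine ⟨w ⟨σ, hσ⟩, fun a b hab => ?_, ?_⟩
      · by_contra hne
        rcases lt_or_gt_of_ne (σ.injective.ne hne) with h | h
        · exact ((hlt ⟨σ, hσ⟩ a b).1 h).ne hab
        · exact ((hlt ⟨σ, hσ⟩ b a).1 h).ne' hab
      · ext a b
        exact hlt ⟨σ, hσ⟩ a b
    · intro σ _ τ _ h
      exact perm_eq_of_lt_iff fun a b => iff_of_eq (congrFun (congrFun h a) b)
  refine (hcard.trans (ncard_inducedOrders_le finrank_euclideanSpace_fin L c)).trans
    ((orderBound_le_card_boundedAscent A d).trans ?_)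
  refine card_le_card_of_injOn (fun σ => Fin.revPerm * σ) ?_ (mul_right_injective _).injOn
  intro σ hσ
  simp only [boundedAscent, coe_filter, mem_univ, true_and, Set.mem_ofPred_eq,
    Equiv.Perm.mul_apply, Fin.revPerm_apply, Fin.val_rev] at hσ ⊢
  intro n hn
  have := hσ n
  omega

end
end
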